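/- For every γ > 1 with γ ≠ 2, the σ-symbol function is strictly decreasing in the integer variable k: for every integer k ≥ 0, C_σ(γ, k+1) < C_σ(γ, k). (For γ = 2 one has C_σ(2, k) = 1 for all k ≥ 0.) -/

import Mathlib

noncomputable section

/-- The `σ`-symbol function
`C_σ(γ,k) = [Γ(2k/γ+1)·Γ(2k−2k/γ+1)/Γ(k+1)²]·(γ/2)^{2k+2}·(γ−1)^{2k/γ−2k−1}`. -/
def Csigma (γ : ℝ) (k : ℕ) : ℝ :=
  Real.Gamma (2 * (k : ℝ) / γ + 1) * Real.Gamma (2 * (k : ℝ) - 2 * (k : ℝ) / γ + 1) /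
      Real.Gamma ((k : ℝ) + 1) ^ 2 *
    (γ / 2) ^ (2 * k + 2) *
    (γ - 1) ^ (2 * (k : ℝ) / γ - 2 * (k : ℝ) - 1)

lemma cs_step (y z : ℝ) (hy : 0 ≤ y) (hz : 1 ≤ z) :
    2 * y / z ^ 2 - 2 * y ^ 2 / z ^ 3 ≤
      (2 * y / (z - 1 / 2) - y ^ 2 / ((z - 1) ^ 2 + (z - 1) + 1 / 2)) -
      (2 * y / (z + 1 / 2) - y ^ 2 / (z ^ 2 + z + 1 / 2)) := by
  have h1 : 2 * y / (z - 1 / 2) - 2 * y / (z + 1 / 2) = 2 * y / (z ^ 2 - 1 / 4) := by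
    have a : z - 1 / 2 ≠ 0 := by linarith
    have b : z + 1 / 2 ≠ 0 := by linarith
    have c : z ^ 2 - 1 / 4 ≠ 0 := by nlinarith
    rw [div_sub_div _ _ a b, div_eq_div_iff (mul_ne_zero a b) c]; ring
  have h2 : y ^ 2 / ((z - 1) ^ 2 + (z - 1) + 1 / 2) - y ^ 2 / (z ^ 2 + z + 1 / 2)
      = 2 * y ^ 2 * z / (z ^ 4 + 1 / 4) := by
    have a : (z - 1) ^ 2 + (z - 1) + 1 / 2 ≠ 0 := by nlinarith
    have b : z ^ 2 + z + 1 / 2 ≠ 0 := by nlinarith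
    have c : z ^ 4 + 1 / 4 ≠ 0 := by positivity
    rw [div_sub_div _ _ a b, div_eq_div_iff (mul_ne_zero a b) c]; ring
  have h3 : 2 * y / z ^ 2 ≤ 2 * y / (z ^ 2 - 1 / 4) :=
    div_le_div_of_nonneg_left (by positivity) (by nlinarith) (by linarith)
  have h4 : 2 * y ^ 2 * z / (z ^ 4 + 1 / 4) ≤ 2 * y ^ 2 / z ^ 3 := by
    rw [div_le_div_iff₀ (by positivity) (by positivity)]
    nlinarith [sq_nonneg y]
  linarith

lemma cs_sum (y : ℝ) (hy : 0 ≤ y) (n : ℕ) :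
    ∑ j ∈ Finset.range n, 2 * y * ((j : ℝ) + 1) / (y + (j + 1)) ^ 3 ≤
      1 - 1 / ((2 * y + 1) * (2 * y ^ 2 + 2 * y + 1)) := by
  have key : ∑ j ∈ Finset.range n, 2 * y * ((j : ℝ) + 1) / (y + (j + 1)) ^ 3 ≤
      1 - 1 / ((2 * y + 1) * (2 * y ^ 2 + 2 * y + 1)) -
      (2 * y / ((y + n) + 1 / 2) - y ^ 2 / ((y + n) ^ 2 + (y + n) + 1 / 2)) := by
    induction n with
    | zero =>
      simp only [Finset.range_zero, Finset.sum_empty, Nat.cast_zero, add_zero]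
      apply le_of_eq
      field_simp
      ring
    | succ n ih =>
      rw [Finset.sum_range_succ]
      have h := cs_step y (y + (n + 1)) hy (by have : (0:ℝ) ≤ n := n.cast_nonneg
                                               linarith)
      have e : 2 * y * ((n : ℝ) + 1) / (y + (n + 1)) ^ 3 =
          2 * y / (y + (n + 1)) ^ 2 - 2 * y ^ 2 / (y + (n + 1)) ^ 3 := by
        have : y + ((n:ℝ) + 1) ≠ 0 := by positivity
        field_simp
        ring
      have e1 : y + ((n:ℝ) + 1) - 1 / 2 = y + n + 1 / 2 := by ring
      have e2 : y + ((n:ℝ) + 1) - 1 = y + n := by ring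
      rw [e1, e2] at h
      rw [e]
      push_cast
      linarith
  have h0 : y ^ 2 / ((y + n) ^ 2 + (y + n) + 1 / 2) ≤ 2 * y / ((y + n) + 1 / 2) := by
    rw [div_le_div_iff₀ (by positivity) (by positivity)]
    have : (0:ℝ) ≤ n := n.cast_nonneg
    have h5 : 0 ≤ y * (y * n + y ^ 2 + y * (1/2) + 4 * y * n + 2 * n ^ 2 + 2*y+2*n + 1 - y*n) := by
      have : 0 ≤ y * (n:ℝ) := by positivity
      apply mul_nonneg hy
      nlinarith [sq_nonneg y, sq_nonneg (n:ℝ)]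
    have h6 : 0 ≤ y * (3 * y * n) := by positivity
    nlinarith [mul_nonneg hy hy, mul_nonneg (mul_nonneg hy hy) this]
  linarith

lemma cs_mono (Y : ℝ) (hY : 0 ≤ Y) (n : ℕ) (c : ℝ)
    (hc : c = 1 / ((2 * Y + 1) * (2 * Y ^ 2 + 2 * Y + 1))) :
    MonotoneOn (fun y : ℝ => (1 - c) * y -
      ∑ j ∈ Finset.range n, (y / (y + ((j : ℝ) + 1))) ^ 2) (Set.Icc 0 Y) := by
  have hd : ∀ y : ℝ, 0 ≤ y → HasDerivAt (fun y : ℝ => (1 - c) * y -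
      ∑ j ∈ Finset.range n, (y / (y + ((j : ℝ) + 1))) ^ 2)
      ((1 - c) * 1 - ∑ j ∈ Finset.range n, 2 * y * ((j : ℝ) + 1) / (y + (j + 1)) ^ 3) y := by
    intro y hy
    apply HasDerivAt.sub ((hasDerivAt_id y).const_mul _)
    apply HasDerivAt.fun_sum
    intro j _
    have hne : y + ((j : ℝ) + 1) ≠ 0 := by positivity
    refine (((hasDerivAt_id' y).fun_div ((hasDerivAt_id' y).add_const ((j:ℝ)+1)) hne).fun_pow 2).congr_deriv ?_
    have e : (y + ((j : ℝ) + 1)) - y = (j : ℝ) + 1 := by ring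
    simp only [Nat.cast_ofNat, Nat.add_one_sub_one, pow_one, one_mul, mul_one, e,
      show 2 - 1 = 1 from rfl]
    field_simp
  apply monotoneOn_of_hasDerivWithinAt_nonneg (convex_Icc 0 Y)
    (f' := fun y => ((1 - c) * 1 - ∑ j ∈ Finset.range n, 2 * y * ((j : ℝ) + 1) / (y + (j + 1)) ^ 3))
  · exact fun y hy => (hd y hy.1).continuousAt.continuousWithinAt
  · intro y hy
    rw [interior_Icc] at hy
    exact (hd y hy.1.le).hasDerivWithinAt
  · intro y hy
    rw [interior_Icc] at hy
    obtain ⟨h0, h1⟩ := hy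
    have := cs_sum y h0.le n
    have : c ≤ 1 / ((2 * y + 1) * (2 * y ^ 2 + 2 * y + 1)) := by
      rw [hc]
      gcongr
    linarith

lemma cs_convex (k n : ℕ) (c : ℝ)
    (hc : c = 1 / ((2 * (2 * ((k:ℝ) + 1)) + 1) * (2 * (2 * ((k:ℝ) + 1)) ^ 2 + 2 * (2 * ((k:ℝ) + 1)) + 1))) :
    ConvexOn ℝ (Set.Ioo 0 2) (fun x : ℝ => (1 - c) * (x * Real.log x) +
      ∑ j ∈ Finset.range n, (Real.log (((k:ℝ) + 1) * x + ((j:ℝ) + 1)) -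
        Real.log ((k:ℝ) * x + ((j:ℝ) + 1)))) := by
  have hlin : ∀ (a b x : ℝ), HasDerivAt (fun x : ℝ => a * x + b) a x := by
    intro a b x
    simpa using ((hasDerivAt_id' x).const_mul a).add_const b
  apply convexOn_of_hasDerivWithinAt2_nonneg (convex_Ioo 0 2)
    (f' := fun x => (1 - c) * (Real.log x + 1) + ∑ j ∈ Finset.range n,
      (((k:ℝ) + 1) / (((k:ℝ) + 1) * x + ((j:ℝ) + 1)) - (k:ℝ) / ((k:ℝ) * x + ((j:ℝ) + 1))))
    (f'' := fun x => (1 - c) * x⁻¹ + ∑ j ∈ Finset.range n,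
      (-(((k:ℝ) + 1) / (((k:ℝ) + 1) * x + ((j:ℝ) + 1))) ^ 2 + ((k:ℝ) / ((k:ℝ) * x + ((j:ℝ) + 1))) ^ 2))
  · intro x hx
    have hx0 := hx.1
    apply ContinuousAt.continuousWithinAt
    have h0 : x ≠ 0 := hx0.ne'
    have h1 : ∀ j : ℕ, ((k:ℝ) + 1) * x + ((j:ℝ) + 1) ≠ 0 := fun j => by positivity
    have h2 : ∀ j : ℕ, (k:ℝ) * x + ((j:ℝ) + 1) ≠ 0 := fun j => by positivity
    fun_prop (disch := aesop)
  · intro x hx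
    rw [interior_Ioo] at hx
    have hx0 := hx.1
    apply HasDerivAt.hasDerivWithinAt
    apply HasDerivAt.add
    · exact (Real.hasDerivAt_mul_log hx0.ne').const_mul _
    · apply HasDerivAt.fun_sum
      intro j _
      exact ((hlin _ _ x).log (by positivity)).sub ((hlin _ _ x).log (by positivity))
  · intro x hx
    rw [interior_Ioo] at hx
    have hx0 := hx.1
    apply HasDerivAt.hasDerivWithinAt
    apply HasDerivAt.add
    · exact ((Real.hasDerivAt_log hx0.ne').add_const 1).const_mul _
    · apply HasDerivAt.fun_sum
      intro j _
      have hh : ∀ a : ℝ, 0 ≤ a → HasDerivAt (fun x : ℝ => a / (a * x + ((j:ℝ) + 1)))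
          (-(a / (a * x + ((j:ℝ) + 1))) ^ 2) x := by
        intro a ha
        have hne : a * x + ((j:ℝ) + 1) ≠ 0 := by positivity
        refine ((hasDerivAt_const x a).fun_div (hlin a ((j:ℝ) + 1) x) hne).congr_deriv ?_
        field_simp
        ring
      have := (hh (k+1) (by positivity)).sub (hh k (by positivity))
      rw [sub_neg_eq_add] at this
      exact this
  · intro x hx
    rw [interior_Ioo] at hx
    obtain ⟨hx0, hx2⟩ := hx
    have hm := cs_mono (2 * ((k:ℝ) + 1)) (by positivity) n c hc
      (a := k * x) (b := (k + 1) * x)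
      ⟨by positivity, by nlinarith [(k.cast_nonneg : (0:ℝ) ≤ k)]⟩
      ⟨by positivity, by nlinarith [(k.cast_nonneg : (0:ℝ) ≤ k)]⟩ (by linarith)
    simp only at hm
    have : (1 - c) * x⁻¹ + ∑ j ∈ Finset.range n,
      (-(((k:ℝ) + 1) / (((k:ℝ) + 1) * x + ((j:ℝ) + 1))) ^ 2 + ((k:ℝ) / ((k:ℝ) * x + ((j:ℝ) + 1))) ^ 2)
      = (((1 - c) * ((k + 1) * x) -
      ∑ j ∈ Finset.range n, (((k + 1) * x) / (((k + 1) * x) + ((j : ℝ) + 1))) ^ 2) -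
      ((1 - c) * (k * x) -
      ∑ j ∈ Finset.range n, ((k * x) / ((k * x) + ((j : ℝ) + 1))) ^ 2)) / x ^ 2 := by
      rw [eq_div_iff (by positivity), add_mul, Finset.sum_mul, sub_sub_sub_comm, ← Finset.sum_sub_distrib,
        sub_eq_add_neg (_ - _) (Finset.sum _ _), ← Finset.sum_neg_distrib]
      congr 1
      · field_simp; ring
      · apply Finset.sum_congr rfl
        intro j _
        ring
    rw [this]
    apply div_nonneg _ (by positivity)
    linarith

lemma cs_main (k : ℕ) (x : ℝ) (hx0 : 0 < x) (hx2 : x < 2) (hx1 : x ≠ 1) :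
    (Real.log (Real.Gamma (((k:ℝ) + 1) * x + 1)) - Real.log (Real.Gamma ((k:ℝ) * x + 1))) +
    (Real.log (Real.Gamma (((k:ℝ) + 1) * (2 - x) + 1)) - Real.log (Real.Gamma ((k:ℝ) * (2 - x) + 1))) -
    2 * (Real.log (Real.Gamma (((k:ℝ) + 1) * 1 + 1)) - Real.log (Real.Gamma ((k:ℝ) * 1 + 1)))
     < x * Real.log x + (2 - x) * Real.log (2 - x) := by
  have hy0 : 0 < 2 - x := by linarith
  set c : ℝ := 1 / ((2 * (2 * ((k:ℝ) + 1)) + 1) * (2 * (2 * ((k:ℝ) + 1)) ^ 2 + 2 * (2 * ((k:ℝ) + 1)) + 1)) with hc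
  have hc0 : 0 < c := by positivity
  have hpos : 0 < x * Real.log x + (2 - x) * Real.log (2 - x) := by
    have := Real.strictConvexOn_mul_log.2 (x := x) (y := 2 - x) hx0.le hy0.le
      (by intro h; apply hx1; linarith) (by norm_num : (0:ℝ) < 1/2) (by norm_num : (0:ℝ) < 1/2) (by norm_num)
    simp only [smul_eq_mul] at this
    rw [show 1 / 2 * x + 1 / 2 * (2 - x) = 1 by ring] at this
    simp at this
    linarith
  have ht : ∀ z : ℝ, 0 < z → Filter.Tendsto (Real.BohrMollerup.logGammaSeq z) Filter.atTop
      (nhds (Real.log (Real.Gamma z))) := fun z hz => Real.BohrMollerup.tendsto_log_gamma hz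
  have hlim := (((ht (((k:ℝ) + 1) * x + 1) (by positivity)).sub (ht ((k:ℝ) * x + 1) (by positivity))).add
    ((ht (((k:ℝ) + 1) * (2 - x) + 1) (by positivity)).sub (ht ((k:ℝ) * (2 - x) + 1) (by positivity)))).sub
    (((ht (((k:ℝ) + 1) * 1 + 1) (by positivity)).sub (ht ((k:ℝ) * 1 + 1) (by positivity))).const_mul 2)
  have hle := le_of_tendsto' hlim (b := (1 - c) * (x * Real.log x + (2 - x) * Real.log (2 - x))) (by
    intro n
    have hcv := (cs_convex k (n + 1) c hc).2 (x := x) (y := 2 - x) ⟨hx0, hx2⟩ ⟨hy0, by linarith⟩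
      (by norm_num : (0:ℝ) ≤ 1/2) (by norm_num : (0:ℝ) ≤ 1/2) (by norm_num)
    simp only [smul_eq_mul] at hcv
    rw [show 1 / 2 * x + 1 / 2 * (2 - x) = 1 by ring] at hcv
    simp only [Finset.sum_sub_distrib, Real.log_one] at hcv
    simp only [Real.BohrMollerup.logGammaSeq, add_assoc, add_comm (1:ℝ)] at hcv ⊢
    linarith)
  nlinarith

lemma cs_log (γ : ℝ) (hγ : 1 < γ) (k : ℕ) : 0 < Csigma γ k ∧
    Real.log (Csigma γ k) = Real.log (Real.Gamma ((k:ℝ) * (2 / γ) + 1)) +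
      Real.log (Real.Gamma ((k:ℝ) * (2 - 2 / γ) + 1)) - 2 * Real.log (Real.Gamma ((k:ℝ) * 1 + 1))
      - (2 * (k:ℝ) + 2) * Real.log (2 / γ)
      + ((k:ℝ) * (2 / γ) - 2 * k - 1) * (Real.log (2 - 2 / γ) - Real.log (2 / γ)) := by
  have h0 : 0 < γ := by linarith
  have hx : 0 < 2 / γ := by positivity
  have hy : 0 < 2 - 2 / γ := by
    have : 2 / γ < 2 := by rw [div_lt_iff₀ h0]; linarith
    linarith
  have hA : 0 < Real.Gamma ((k:ℝ) * (2 / γ) + 1) := Real.Gamma_pos_of_pos (by positivity)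
  have hB : 0 < Real.Gamma ((k:ℝ) * (2 - 2 / γ) + 1) := Real.Gamma_pos_of_pos (by positivity)
  have hC : 0 < Real.Gamma ((k:ℝ) * 1 + 1) := Real.Gamma_pos_of_pos (by positivity)
  have hE : 0 < γ - 1 := by linarith
  have e1 : 2 * (k : ℝ) / γ = (k:ℝ) * (2 / γ) := by ring
  have e2 : 2 * (k : ℝ) - (k:ℝ) * (2 / γ) = (k:ℝ) * (2 - 2 / γ) := by ring
  have e3 : γ / 2 = (2 / γ)⁻¹ := by rw [inv_div]
  have e4 : γ - 1 = (2 - 2 / γ) / (2 / γ) := by field_simp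
  have hP : 0 < (γ - 1) ^ ((k:ℝ) * (2 / γ) - 2 * (k : ℝ) - 1) := Real.rpow_pos_of_pos hE _
  have e5 : (k:ℝ) + 1 = (k:ℝ) * 1 + 1 := by ring
  unfold Csigma
  rw [e1, e2, e5]
  refine ⟨by positivity, ?_⟩
  rw [Real.log_mul (by positivity) hP.ne', Real.log_mul (by positivity) (by positivity),
    Real.log_div (by positivity) (by positivity), Real.log_mul hA.ne' hB.ne', Real.log_pow,
    Real.log_pow, Real.log_rpow hE, e3, Real.log_inv, e4, Real.log_div hy.ne' hx.ne']
  push_cast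
  ring

/-- For every `γ > 1` with `γ ≠ 2`, the `σ`-symbol function is strictly
decreasing in `k`: `C_σ(γ, k+1) < C_σ(γ, k)` for all `k ≥ 0`. (For `γ = 2` one
has `C_σ(2, k) = 1` for all `k ≥ 0`.) -/
theorem Csigma_strictly_decreasing (γ : ℝ) (hγ : 1 < γ) :
    (γ ≠ 2 → ∀ k : ℕ, Csigma γ (k + 1) < Csigma γ k) ∧
    (γ = 2 → ∀ k : ℕ, Csigma γ k = 1) := by
  refine ⟨fun h2 k => ?_, fun h2 k => ?_⟩
  · have h0 : 0 < γ := by linarith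
    obtain ⟨hp, hl⟩ := cs_log γ hγ k
    obtain ⟨hp', hl'⟩ := cs_log γ hγ (k + 1)
    have hm := cs_main k (2 / γ) (by positivity) (by rw [div_lt_iff₀ h0]; linarith) (by
      intro h
      rw [div_eq_iff h0.ne'] at h
      apply h2
      linarith)
    rw [← Real.log_lt_log_iff hp' hp, hl, hl']
    push_cast
    linarith
  · subst h2
    have hC : 0 < Real.Gamma ((k:ℝ) + 1) := Real.Gamma_pos_of_pos (by positivity)
    have e1 : 2 * (k : ℝ) / 2 = k := by ring
    have e2 : 2 * (k : ℝ) - k = k := by ring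
    have e3 : (2 : ℝ) - 1 = 1 := by norm_num
    unfold Csigma
    rw [e1, e2, e3, Real.one_rpow, div_self two_ne_zero, one_pow, mul_one, mul_one, ← pow_two]
    exact div_self (by positivity)
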